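/- Let k ≥ 2, s > 2k, C ≥ 2 and δ = 8^{−2k}. Then, uniformly in 0 < η ≤ 2 and P ≥ 2, ∫_{Λ_k^{(s)}(C)} ∫_{|α| > P^{1/3−k}} |f(λ_1 α) f(λ_2 α) ⋯ f(λ_s α)| d_η α dλ ≪ P^{s−k−10δ}, with an implicit constant depending only on k, s, C. -/

import Mathlib

open MeasureTheory

/-- e(t) = e^{2πit}. -/
noncomputable def eF (t : ℝ) : ℂ := Complex.exp (2 * Real.pi * Complex.I * t)

/-- The Weyl sum f(α) = Σ_{x ∈ ℤ, |x| ≤ P} e(α x^k). -/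
noncomputable def fW (k : ℕ) (P α : ℝ) : ℂ :=
  ∑ x ∈ Finset.Icc (-(⌊P⌋ : ℤ)) ⌊P⌋, eF (α * (x : ℝ) ^ k)

/-- The measure d_η α = η (sin(πηα)/(πηα))² dα on ℝ. -/
noncomputable def dEta (η : ℝ) : Measure ℝ :=
  volume.withDensity fun α =>
    ENNReal.ofReal (η * (Real.sin (Real.pi * η * α) / (Real.pi * η * α)) ^ 2)

/-- δ = 8^{−2k}. -/
noncomputable def dlt (k : ℕ) : ℝ := ((8 : ℝ) ^ (2 * k))⁻¹

/-- Λ_k^{(s)}: s-tuples of nonzero reals; for even k additionally some λ_i λ_j < 0. -/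
def Lam (k s : ℕ) : Set (Fin s → ℝ) :=
  {l | (∀ j, l j ≠ 0) ∧ (Even k → ∃ i j, l i * l j < 0)}

/-- Λ_k^{(s)}(C) = {λ ∈ Λ_k^{(s)} : 1/C ≤ |λ_j| ≤ C}. -/
def LamC (k s : ℕ) (C : ℝ) : Set (Fin s → ℝ) :=
  {l | l ∈ Lam k s ∧ ∀ j, 1 / C ≤ |l j| ∧ |l j| ≤ C}

/-- The one-sided Weyl sum `Σ_{1 ≤ n ≤ N} e(β n^k)`. -/
noncomputable def posWeylSum (k N : ℕ) (β : ℝ) : ℂ :=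
  ∑ n ∈ Finset.Icc 1 N, eF (β * (n : ℝ) ^ k)

lemma eF_eq_cos_add_sin (t : ℝ) :
    eF t = (Real.cos (2 * Real.pi * t) : ℂ) + (Real.sin (2 * Real.pi * t) : ℂ) * Complex.I := by
  rw [eF, Complex.ofReal_cos, Complex.ofReal_sin, ← Complex.exp_mul_I]
  congr 1
  push_cast
  ring

lemma eF_neg (t : ℝ) : eF (-t) = (starRingEnd ℂ) (eF t) := by
  simp [eF_eq_cos_add_sin, Complex.conj_ofReal, -Complex.ofReal_cos, -Complex.ofReal_sin]

lemma continuous_eF : Continuous eF := by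
  unfold eF
  fun_prop

lemma continuous_fW (k : ℕ) (P : ℝ) : Continuous (fW k P) := by
  unfold fW
  exact continuous_finsetSum _ fun x _ => continuous_eF.comp (by fun_prop)

lemma continuous_posWeylSum (k N : ℕ) : Continuous (posWeylSum k N) := by
  unfold posWeylSum
  exact continuous_finsetSum _ fun x _ => continuous_eF.comp (by fun_prop)

lemma sum_Icc_neg_eq (g : ℤ → ℂ) (N : ℕ) :
    ∑ x ∈ Finset.Icc (-(N : ℤ)) N, g x
      = g 0 + ∑ n ∈ Finset.Icc 1 N, g n + ∑ n ∈ Finset.Icc 1 N, g (-n) := by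
  induction N with
  | zero => simp
  | succ N ih =>
    have h : Finset.Icc (-((N + 1 : ℕ) : ℤ)) ((N + 1 : ℕ) : ℤ)
        = insert ((N + 1 : ℕ) : ℤ) (insert (-((N + 1 : ℕ) : ℤ)) (Finset.Icc (-(N : ℤ)) N)) := by
      ext x
      simp only [Finset.mem_Icc, Finset.mem_insert]
      omega
    rw [h, Finset.sum_insert, Finset.sum_insert, ih, Finset.sum_Icc_succ_top (by omega),
      Finset.sum_Icc_succ_top (by omega)]
    · ring
    · simp
    · simp only [Finset.mem_insert, Finset.mem_Icc]
      omega

lemma norm_fW_le (k : ℕ) {P : ℝ} (hP : 0 ≤ P) (β : ℝ) :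
    ‖fW k P β‖ ≤ 1 + 2 * ‖posWeylSum k ⌊P⌋₊ β‖ := by
  have hfl : (⌊P⌋ : ℤ) = (⌊P⌋₊ : ℤ) := (Int.natCast_floor_eq_floor hP).symm
  have hneg : ‖∑ n ∈ Finset.Icc 1 ⌊P⌋₊, eF (β * (((-(n : ℤ) : ℤ) : ℝ)) ^ k)‖
      = ‖posWeylSum k ⌊P⌋₊ β‖ := by
    rcases Nat.even_or_odd k with h | h
    · simp [posWeylSum, h.neg_pow]
    · simp only [Int.cast_neg, Int.cast_natCast, h.neg_pow, mul_neg, eF_neg, ← map_sum]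
      rw [RCLike.norm_conj, posWeylSum]
  have h0 : ∀ t : ℝ, ‖eF t‖ = 1 := fun t => by
    rw [eF, show 2 * (Real.pi : ℂ) * Complex.I * t = ((2 * Real.pi * t : ℝ) : ℂ) * Complex.I by
      push_cast; ring, Complex.norm_exp_ofReal_mul_I]
  rw [fW, hfl, sum_Icc_neg_eq]
  refine (norm_add_le _ _).trans ?_
  rw [hneg]
  refine (add_le_add_left (norm_add_le _ _) _).trans ?_
  rw [h0]
  simp only [Int.cast_natCast]
  rw [← posWeylSum]
  linarith

lemma norm_posWeylSum_sq (k N : ℕ) (β : ℝ) :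
    ‖posWeylSum k N β‖ ^ 2 = ∑ m ∈ Finset.Icc 1 N, ∑ n ∈ Finset.Icc 1 N,
      Real.cos (2 * Real.pi * β * ((m : ℝ) ^ k - (n : ℝ) ^ k)) := by
  have h1 : (posWeylSum k N β).re
      = ∑ n ∈ Finset.Icc 1 N, Real.cos (2 * Real.pi * (β * (n : ℝ) ^ k)) := by
    rw [posWeylSum, Complex.re_sum]
    simp [eF_eq_cos_add_sin, -Complex.ofReal_cos, -Complex.ofReal_sin]
  have h2 : (posWeylSum k N β).im
      = ∑ n ∈ Finset.Icc 1 N, Real.sin (2 * Real.pi * (β * (n : ℝ) ^ k)) := by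
    rw [posWeylSum, Complex.im_sum]
    simp [eF_eq_cos_add_sin, -Complex.ofReal_cos, -Complex.ofReal_sin]
  rw [← Complex.normSq_eq_norm_sq, Complex.normSq_apply, h1, h2, Finset.sum_mul_sum,
    Finset.sum_mul_sum, ← Finset.sum_add_distrib]
  refine Finset.sum_congr rfl fun m _ => ?_
  rw [← Finset.sum_add_distrib]
  refine Finset.sum_congr rfl fun n _ => ?_
  rw [← Real.cos_sub]
  congr 1
  ring

lemma abs_integral_cos_le {C ω θ : ℝ} (hC : 1 ≤ C) (hω : ω ≠ 0) (hθ0 : 0 ≤ θ) (hθ1 : θ ≤ 1) :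
    |∫ x in (-C)..C, Real.cos (ω * x)| ≤ 2 * C * |ω| ^ (-θ) := by
  have hpos : 0 < |ω| := abs_pos.mpr hω
  rcases le_total |ω| 1 with h | h
  · have h1 : |∫ x in (-C)..C, Real.cos (ω * x)| ≤ 1 * |C - -C| :=
      intervalIntegral.norm_integral_le_of_norm_le_const (f := fun x => Real.cos (ω * x))
        fun x _ => Real.abs_cos_le_one _
    have h2 : 1 ≤ |ω| ^ (-θ) := Real.one_le_rpow_of_pos_of_le_one_of_nonpos hpos h (by linarith)
    rw [abs_of_nonneg (by linarith : 0 ≤ C - -C)] at h1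
    nlinarith
  · have h1 : |∫ x in (-C)..C, Real.cos (ω * x)| ≤ 2 * |ω|⁻¹ := by
      rw [intervalIntegral.integral_comp_mul_left _ hω, integral_cos, smul_eq_mul, abs_mul,
        abs_inv, mul_comm]
      refine mul_le_mul_of_nonneg_right ?_ (by positivity)
      have ha := abs_le.mp (Real.abs_sin_le_one (ω * C))
      have hb := abs_le.mp (Real.abs_sin_le_one (ω * -C))
      rw [abs_le]
      constructor <;> linarith
    have h2 : |ω|⁻¹ ≤ |ω| ^ (-θ) := by
      rw [← Real.rpow_neg_one]
      exact Real.rpow_le_rpow_of_exponent_le h (by linarith)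
    have : 0 ≤ |ω| ^ (-θ) := by positivity
    nlinarith

lemma mul_pow_le_sq_pow_sub_pow {k : ℕ} (hk : 2 ≤ k) {a b : ℝ} (hb : 0 ≤ b) (hab : b ≤ a) :
    ((a - b) * a) ^ k ≤ (a ^ k - b ^ k) ^ 2 := by
  obtain ⟨j, rfl⟩ := Nat.exists_eq_add_of_le' hk
  have ha : 0 ≤ a := hb.trans hab
  have hd : 0 ≤ a - b := sub_nonneg.mpr hab
  have h1 : (a - b) * a ^ (j + 1) ≤ a ^ (j + 2) - b ^ (j + 2) := by
    have := mul_le_mul_of_nonneg_right (pow_le_pow_left₀ hb hab (j + 1)) hb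
    rw [pow_succ a (j + 1), pow_succ b (j + 1)]
    linarith
  refine le_trans ?_ (pow_le_pow_left₀ (by positivity) h1 2)
  have h2 : (a - b) ^ j ≤ a ^ j := pow_le_pow_left₀ hd (by linarith) j
  calc ((a - b) * a) ^ (j + 2) = (a - b) ^ j * ((a - b) ^ 2 * a ^ (j + 2)) := by
        rw [mul_pow]
        ring
    _ ≤ a ^ j * ((a - b) ^ 2 * a ^ (j + 2)) := mul_le_mul_of_nonneg_right h2 (by positivity)
    _ = _ := by ring

lemma abs_sub_mul_pow_le {k : ℕ} (hk : 2 ≤ k) {a b : ℝ} (ha : 0 ≤ a) (hb : 0 ≤ b) :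
    (|a - b| * a) ^ k ≤ (a ^ k - b ^ k) ^ 2 := by
  rcases le_total b a with h | h
  · rw [abs_of_nonneg (sub_nonneg.mpr h)]
    exact mul_pow_le_sq_pow_sub_pow hk hb h
  · rw [abs_sub_comm, abs_of_nonneg (sub_nonneg.mpr h), ← neg_sub (b ^ k), neg_sq]
    refine le_trans ?_ (mul_pow_le_sq_pow_sub_pow hk ha h)
    have := sub_nonneg.mpr h
    gcongr

lemma abs_integral_cos_pow_sub_le {k : ℕ} (hk : 2 ≤ k) {C α : ℝ} (hC : 1 ≤ C) (hα : α ≠ 0)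
    {m n : ℕ} (hm : 1 ≤ m) (hmn : m ≠ n) :
    |∫ x in (-C)..C, Real.cos (2 * Real.pi * (x * α) * ((m : ℝ) ^ k - (n : ℝ) ^ k))|
      ≤ 2 * C * |α| ^ (-(2 / k : ℝ)) * (|(m : ℝ) - n|⁻¹ * (m : ℝ)⁻¹) := by
  have hk0 : (0 : ℝ) < k := by positivity
  have hm0 : (0 : ℝ) < m := by exact_mod_cast hm
  have hd : 0 < |(m : ℝ) - n| := abs_pos.mpr (sub_ne_zero.mpr (by exact_mod_cast hmn))
  have hα0 : 0 < |α| := abs_pos.mpr hα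
  set D : ℝ := (m : ℝ) ^ k - (n : ℝ) ^ k with hD
  have hsq : (|(m : ℝ) - n| * m) ^ k ≤ D ^ 2 := abs_sub_mul_pow_le hk hm0.le (Nat.cast_nonneg n)
  have hD0 : 0 < |D| := by
    rw [abs_pos]
    intro h
    have : 0 < (|(m : ℝ) - n| * m) ^ k := by positivity
    rw [h] at hsq
    linarith
  have hroot : |(m : ℝ) - n| * m ≤ |D| ^ (2 / k : ℝ) := by
    rw [← Real.pow_rpow_inv_natCast (x := |(m : ℝ) - n| * m) (by positivity)
      (by omega : k ≠ 0), div_eq_mul_inv, Real.rpow_mul hD0.le, Real.rpow_two, sq_abs]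
    exact Real.rpow_le_rpow (by positivity) hsq (by positivity)
  have hω : 2 * Real.pi * α * D ≠ 0 := by
    have := abs_pos.mp hD0
    have := Real.pi_ne_zero
    positivity
  have hθ1 : (2 / k : ℝ) ≤ 1 := by
    rw [div_le_one hk0]
    exact_mod_cast hk
  have hrew : ∀ x : ℝ, 2 * Real.pi * (x * α) * D = 2 * Real.pi * α * D * x := fun x => by ring
  simp only [hrew]
  refine (abs_integral_cos_le hC hω (by positivity) hθ1).trans ?_
  rw [mul_assoc (2 * C)]
  refine mul_le_mul_of_nonneg_left ?_ (by linarith)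
  have h1 : |α| * |D| ≤ |2 * Real.pi * α * D| := by
    rw [abs_mul, abs_mul, abs_of_pos (by positivity : 0 < 2 * Real.pi)]
    have : 0 < |α| * |D| := by positivity
    nlinarith [Real.pi_gt_three]
  calc |2 * Real.pi * α * D| ^ (-(2 / k : ℝ)) ≤ (|α| * |D|) ^ (-(2 / k : ℝ)) :=
        Real.rpow_le_rpow_of_nonpos (by positivity) h1 (by rw [neg_nonpos]; positivity)
    _ = |α| ^ (-(2 / k : ℝ)) * (|D| ^ (2 / k : ℝ))⁻¹ := by
        rw [Real.mul_rpow hα0.le hD0.le, Real.rpow_neg hD0.le]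
    _ ≤ _ := by
        rw [← mul_inv]
        gcongr

lemma sum_inv_nat_sub_le (m N : ℕ) :
    ∑ n ∈ Finset.range (N + 1), ((n - m : ℕ) : ℝ)⁻¹ ≤ ∑ n ∈ Finset.range (N + 1), (n : ℝ)⁻¹ := by
  have h : ∀ M : ℕ, ∑ n ∈ Finset.range M, ((n - m : ℕ) : ℝ)⁻¹
      = ∑ n ∈ Finset.range (M - m), (n : ℝ)⁻¹ := by
    intro M
    induction M with
    | zero => simp
    | succ M ih =>
      rw [Finset.sum_range_succ, ih]
      rcases le_or_gt m M with h | h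
      · rw [Nat.succ_sub h, Finset.sum_range_succ]
      · simp [Nat.sub_eq_zero_of_le h.le, Nat.sub_eq_zero_of_le (Nat.succ_le_of_lt h)]
  rw [h]
  exact Finset.sum_le_sum_of_subset_of_nonneg (Finset.range_mono (by omega))
    fun _ _ _ => by positivity

lemma sum_inv_nat_sub_le' {m N : ℕ} (hm : m ≤ N) :
    ∑ n ∈ Finset.range (N + 1), ((m - n : ℕ) : ℝ)⁻¹ ≤ ∑ n ∈ Finset.range (N + 1), (n : ℝ)⁻¹ := by
  rw [← Finset.sum_range_reflect]
  refine le_trans (Finset.sum_le_sum fun j hj => ?_) (sum_inv_nat_sub_le (N - m) N)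
  rw [Finset.mem_range] at hj
  rw [show m - (N + 1 - 1 - j) = j - (N - m) by omega]

lemma sum_inv_abs_sub_le {m N : ℕ} (hm : m ≤ N) :
    ∑ n ∈ Finset.Icc 1 N, |(m : ℝ) - n|⁻¹ ≤ 2 * ∑ n ∈ Finset.range (N + 1), (n : ℝ)⁻¹ := by
  have hsub : Finset.Icc 1 N ⊆ Finset.range (N + 1) := fun x hx => by
    simp only [Finset.mem_Icc, Finset.mem_range] at *
    omega
  refine (Finset.sum_le_sum_of_subset_of_nonneg hsub fun _ _ _ => by positivity).trans ?_
  rw [two_mul]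
  refine le_trans (le_of_eq ?_) (add_le_add (sum_inv_nat_sub_le m N) (sum_inv_nat_sub_le' hm))
  rw [← Finset.sum_add_distrib]
  refine Finset.sum_congr rfl fun n _ => ?_
  rcases le_total m n with h | h
  · rw [Nat.sub_eq_zero_of_le h, Nat.cast_sub h, abs_sub_comm,
      abs_of_nonneg (sub_nonneg.mpr (by exact_mod_cast h))]
    simp
  · rw [Nat.sub_eq_zero_of_le h, Nat.cast_sub h,
      abs_of_nonneg (sub_nonneg.mpr (by exact_mod_cast h))]
    simp

lemma sum_range_inv_le {P : ℝ} (hP : 1 ≤ P) :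
    ∑ n ∈ Finset.range (⌊P⌋₊ + 1), (n : ℝ)⁻¹ ≤ 1 + Real.log P := by
  rw [Finset.sum_range_succ']
  have h := harmonic_floor_le_one_add_log P hP
  rw [harmonic] at h
  push_cast at h ⊢
  simpa using h

lemma integral_norm_posWeylSum_sq_le {k : ℕ} (hk : 2 ≤ k) {C α P : ℝ} (hC : 1 ≤ C) (hα : α ≠ 0)
    (hP : 1 ≤ P) :
    ∫ x in (-C)..C, ‖posWeylSum k ⌊P⌋₊ (x * α)‖ ^ 2
      ≤ 4 * C * (P + |α| ^ (-(2 / k : ℝ)) * (1 + Real.log P) ^ 2) := by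
  set N := ⌊P⌋₊ with hN
  set A : ℝ := |α| ^ (-(2 / k : ℝ)) with hA
  set H : ℝ := ∑ n ∈ Finset.range (N + 1), (n : ℝ)⁻¹ with hH
  have hA0 : 0 ≤ A := by positivity
  have hH0 : 0 ≤ H := Finset.sum_nonneg fun _ _ => by positivity
  have hHL : H ≤ 1 + Real.log P := sum_range_inv_le hP
  have hsub : Finset.Icc 1 N ⊆ Finset.range (N + 1) := fun x hx => by
    simp only [Finset.mem_Icc, Finset.mem_range] at *
    omega
  simp only [norm_posWeylSum_sq]
  rw [intervalIntegral.integral_finsetSum fun m _ =>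
    Continuous.intervalIntegrable (by fun_prop) _ _]
  have hrow : ∀ m ∈ Finset.Icc 1 N,
      ∫ x in (-C)..C, ∑ n ∈ Finset.Icc 1 N,
        Real.cos (2 * Real.pi * (x * α) * ((m : ℝ) ^ k - (n : ℝ) ^ k))
      ≤ 2 * C + 4 * C * A * H * (m : ℝ)⁻¹ := by
    intro m hm
    have hm' := Finset.mem_Icc.mp hm
    rw [intervalIntegral.integral_finsetSum fun n _ =>
      Continuous.intervalIntegrable (by fun_prop) _ _]
    calc _ ≤ ∑ n ∈ Finset.Icc 1 N, ((if m = n then 2 * C else 0)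
            + 2 * C * A * (m : ℝ)⁻¹ * |(m : ℝ) - n|⁻¹) := by
          refine Finset.sum_le_sum fun n _ => ?_
          split_ifs with h
          · subst h
            simp
            linarith
          · refine (le_abs_self _).trans
              ((abs_integral_cos_pow_sub_le hk hC hα hm'.1 h).trans (le_of_eq ?_))
            ring
      _ = 2 * C + 2 * C * A * (m : ℝ)⁻¹ * ∑ n ∈ Finset.Icc 1 N, |(m : ℝ) - n|⁻¹ := by
          rw [Finset.sum_add_distrib, Finset.sum_ite_eq, if_pos hm, Finset.mul_sum]
      _ ≤ 2 * C + 2 * C * A * (m : ℝ)⁻¹ * (2 * H) := by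
          gcongr
          exact sum_inv_abs_sub_le hm'.2
      _ = _ := by ring
  refine (Finset.sum_le_sum hrow).trans ?_
  rw [Finset.sum_add_distrib, Finset.sum_const, Nat.card_Icc, nsmul_eq_mul, ← Finset.mul_sum]
  have h1 : ∑ n ∈ Finset.Icc 1 N, (n : ℝ)⁻¹ ≤ H :=
    Finset.sum_le_sum_of_subset_of_nonneg hsub fun _ _ _ => by positivity
  have h2 : ((N + 1 - 1 : ℕ) : ℝ) ≤ P := by
    simpa using Nat.floor_le (by linarith : (0 : ℝ) ≤ P)
  have h3 : H * ∑ n ∈ Finset.Icc 1 N, (n : ℝ)⁻¹ ≤ (1 + Real.log P) ^ 2 := by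
    rw [sq]
    exact mul_le_mul hHL (h1.trans hHL) (Finset.sum_nonneg fun _ _ => by positivity)
      (hH0.trans hHL)
  calc _ ≤ P * (2 * C) + 4 * C * A * (H * ∑ n ∈ Finset.Icc 1 N, (n : ℝ)⁻¹) := by
        rw [mul_assoc (4 * C * A)]
        gcongr
    _ ≤ P * (2 * C) + 4 * C * A * (1 + Real.log P) ^ 2 := by gcongr
    _ ≤ _ := by nlinarith

lemma setIntegral_norm_fW_le {k : ℕ} (hk : 2 ≤ k) {C α P : ℝ} (hC : 1 ≤ C) (hα : α ≠ 0)
    (hP : 1 ≤ P) :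
    ∫ x in Set.Icc (-C) C, ‖fW k P (x * α)‖
      ≤ 8 * C * (√P + |α| ^ (-(1 / k : ℝ)) * (1 + Real.log P)) := by
  have hk0 : (0 : ℝ) < k := by positivity
  have hlog : 0 ≤ Real.log P := Real.log_nonneg hP
  set B : ℝ := |α| ^ (-(1 / k : ℝ)) with hB
  have hB0 : 0 ≤ B := by positivity
  set T : ℝ := √P + B * (1 + Real.log P) with hT
  have hBL : 0 ≤ B * (1 + Real.log P) := by positivity
  have hT1 : 1 ≤ T := by
    have := Real.one_le_sqrt.mpr hP
    linarith
  have hB2 : |α| ^ (-(2 / k : ℝ)) = B ^ 2 := by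
    rw [hB, ← Real.rpow_natCast, ← Real.rpow_mul (abs_nonneg α)]
    congr 1
    push_cast
    ring
  have hsq := integral_norm_posWeylSum_sq_le hk hC hα hP
  have hT2 : P + B ^ 2 * (1 + Real.log P) ^ 2 ≤ T ^ 2 := by
    have h1 : √P ^ 2 = P := Real.sq_sqrt (by linarith)
    have h2 := Real.sqrt_nonneg P
    nlinarith [mul_nonneg h2 hBL]
  rw [hB2] at hsq
  have hcont : Continuous fun x : ℝ => posWeylSum k ⌊P⌋₊ (x * α) :=
    (continuous_posWeylSum k _).comp (by fun_prop)
  have hcontf : Continuous fun x : ℝ => fW k P (x * α) := (continuous_fW k P).comp (by fun_prop)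
  rw [integral_Icc_eq_integral_Ioc, ← intervalIntegral.integral_of_le (by linarith)]
  have hpt : ∀ x : ℝ, ‖fW k P (x * α)‖ ≤ 2 * T + T⁻¹ * ‖posWeylSum k ⌊P⌋₊ (x * α)‖ ^ 2 := by
    intro x
    refine (norm_fW_le k (by linarith) _).trans ?_
    set y := ‖posWeylSum k ⌊P⌋₊ (x * α)‖
    have h1 : T⁻¹ * T = 1 := inv_mul_cancel₀ (by positivity)
    have h2 : 0 ≤ T⁻¹ * (y - T) ^ 2 := by positivity
    have h3 : T⁻¹ * (y - T) ^ 2 = T⁻¹ * y ^ 2 - 2 * y * (T⁻¹ * T) + (T⁻¹ * T) * T := by ring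
    rw [h3, h1] at h2
    linarith
  calc ∫ x in (-C)..C, ‖fW k P (x * α)‖
      ≤ ∫ x in (-C)..C, (2 * T + T⁻¹ * ‖posWeylSum k ⌊P⌋₊ (x * α)‖ ^ 2) := by
        refine intervalIntegral.integral_mono (by linarith) ?_ ?_ hpt
        · exact hcontf.norm.intervalIntegrable _ _
        · exact Continuous.intervalIntegrable (by fun_prop) _ _
    _ = 4 * C * T + T⁻¹ * ∫ x in (-C)..C, ‖posWeylSum k ⌊P⌋₊ (x * α)‖ ^ 2 := by
        rw [intervalIntegral.integral_add (Continuous.intervalIntegrable (by fun_prop) _ _)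
          (Continuous.intervalIntegrable (by fun_prop) _ _), intervalIntegral.integral_const_mul]
        simp
        ring
    _ ≤ 4 * C * T + T⁻¹ * (4 * C * T ^ 2) := by
        gcongr
        exact hsq.trans (by gcongr)
    _ = 8 * C * T := by
        field_simp
        ring

lemma lintegral_LamC_le {k s : ℕ} {C α P B : ℝ}
    (hB : ∫ x in Set.Icc (-C) C, ‖fW k P (x * α)‖ ≤ B) :
    ∫⁻ l in LamC k s C, (‖∏ j, fW k P (l j * α)‖₊ : ENNReal) ≤ ENNReal.ofReal (B ^ s) := by
  have hsub : LamC k s C ⊆ Set.univ.pi fun _ : Fin s => Set.Icc (-C) C :=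
    fun l hl j _ => abs_le.mp (hl.2 j).2
  have hcontf : Continuous fun x : ℝ => fW k P (x * α) := (continuous_fW k P).comp (by fun_prop)
  have hint : Integrable (fun x : ℝ => ‖fW k P (x * α)‖) (volume.restrict (Set.Icc (-C) C)) :=
    hcontf.norm.continuousOn.integrableOn_compact isCompact_Icc
  calc _ ≤ ∫⁻ l in Set.univ.pi fun _ : Fin s => Set.Icc (-C) C,
          (‖∏ j, fW k P (l j * α)‖₊ : ENNReal) := lintegral_mono_set hsub
    _ = ∫⁻ l, ENNReal.ofReal (∏ j, ‖fW k P (l j * α)‖)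
          ∂(Measure.pi fun _ : Fin s => volume.restrict (Set.Icc (-C) C)) := by
        rw [volume_pi, Measure.restrict_pi_pi]
        refine lintegral_congr fun l => ?_
        rw [← norm_prod, ofReal_norm, enorm_eq_nnnorm]
    _ = ENNReal.ofReal (∫ l, ∏ j, ‖fW k P (l j * α)‖
          ∂(Measure.pi fun _ : Fin s => volume.restrict (Set.Icc (-C) C))) := by
        rw [ofReal_integral_eq_lintegral_ofReal]
        · exact Integrable.fintype_prod fun _ => hint
        · exact Filter.Eventually.of_forall fun l => Finset.prod_nonneg fun _ _ => norm_nonneg _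
    _ ≤ _ := by
        rw [integral_fintype_prod_eq_prod (fun _ x => ‖fW k P (x * α)‖)]
        simp only [Finset.prod_const, Finset.card_univ, Fintype.card_fin]
        gcongr

lemma sinc_sq_le {η α : ℝ} (hη : 0 < η) :
    η * (Real.sin (Real.pi * η * α) / (Real.pi * η * α)) ^ 2 ≤ 2 * (η * (1 + (η * α) ^ 2)⁻¹) := by
  rw [mul_left_comm 2]
  refine mul_le_mul_of_nonneg_left ?_ hη.le
  set y := Real.pi * η * α with hy
  rcases eq_or_ne y 0 with h | h
  · rw [h]
    simp
    positivity
  have hy2 : 0 < y ^ 2 := by positivity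
  rw [div_pow, ← div_eq_mul_inv, div_le_div_iff₀ hy2 (by positivity)]
  have h1 : Real.sin y ^ 2 ≤ 1 := Real.sin_sq_le_one y
  have h2 : Real.sin y ^ 2 ≤ y ^ 2 := sq_le_sq.mpr Real.abs_sin_le_abs
  have h3 : (η * α) ^ 2 ≤ y ^ 2 := by
    have : y ^ 2 = Real.pi ^ 2 * (η * α) ^ 2 := by rw [hy]; ring
    rw [this]
    have : 1 ≤ Real.pi ^ 2 := one_le_pow₀ (by linarith [Real.pi_gt_three])
    exact le_mul_of_one_le_left (sq_nonneg _) this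
  nlinarith [sq_nonneg (η * α), sq_nonneg (Real.sin y)]

lemma dEta_univ_le {η : ℝ} (hη : 0 < η) : dEta η Set.univ ≤ ENNReal.ofReal (2 * Real.pi) := by
  rw [dEta, withDensity_apply _ MeasurableSet.univ, Measure.restrict_univ]
  refine (lintegral_mono fun α => ENNReal.ofReal_le_ofReal (sinc_sq_le hη)).trans ?_
  have hint : Integrable fun α : ℝ => 2 * (η * (1 + (η * α) ^ 2)⁻¹) :=
    ((integrable_inv_one_add_sq.comp_mul_left' hη.ne').const_mul η).const_mul 2
  rw [← ofReal_integral_eq_lintegral_ofReal hint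
    (Filter.Eventually.of_forall fun α => by positivity)]
  refine ENNReal.ofReal_le_ofReal (le_of_eq ?_)
  rw [integral_const_mul, integral_const_mul,
    Measure.integral_comp_mul_left (fun x : ℝ => (1 + x ^ 2)⁻¹), integral_univ_inv_one_add_sq,
    abs_of_pos (inv_pos.mpr hη), smul_eq_mul, mul_inv_cancel_left₀ hη.ne']

lemma dEta_le {η : ℝ} (hη2 : η ≤ 2) : dEta η ≤ (2 : ENNReal) • volume := by
  rw [dEta, ← withDensity_const]
  refine withDensity_mono (Filter.Eventually.of_forall fun α => ?_)
  refine ENNReal.ofReal_le_of_le_toReal ?_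
  set y := Real.pi * η * α
  have h : (Real.sin y / y) ^ 2 ≤ 1 := by
    rw [div_pow]
    exact div_le_one_of_le₀ (sq_le_sq.mpr Real.abs_sin_le_abs) (sq_nonneg y)
  rw [ENNReal.toReal_ofNat]
  nlinarith

lemma lintegral_abs_rpow_le {A p : ℝ} (hA : 0 < A) (hp : 2 ≤ p) :
    ∫⁻ α in {α : ℝ | A < |α|}, ENNReal.ofReal (|α| ^ (-p))
      ≤ ENNReal.ofReal (2 * A ^ (1 - p)) := by
  have hint : IntegrableOn (fun α : ℝ => α ^ (-p)) (Set.Ioi A) :=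
    integrableOn_Ioi_rpow_of_lt (by linarith) hA
  have hright : ∫⁻ α in Set.Ioi A, ENNReal.ofReal (|α| ^ (-p)) ≤ ENNReal.ofReal (A ^ (1 - p)) := by
    rw [setLIntegral_congr_fun (g := fun α => ENNReal.ofReal (α ^ (-p))) measurableSet_Ioi
      fun α hα => by simp only [abs_of_pos (hA.trans (Set.mem_Ioi.mp hα))],
      ← ofReal_integral_eq_lintegral_ofReal hint]
    · rw [integral_Ioi_rpow_of_lt (by linarith) hA]
      refine ENNReal.ofReal_le_ofReal ?_
      rw [show -p + 1 = -(p - 1) by ring, neg_div_neg_eq, show -(p - 1) = 1 - p by ring]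
      exact div_le_self (by positivity) (by linarith)
    · filter_upwards [self_mem_ae_restrict measurableSet_Ioi] with α hα
      have : 0 < α := hA.trans hα
      positivity
  have hset : {α : ℝ | A < |α|} = Set.Iio (-A) ∪ Set.Ioi A := by
    ext α
    simp only [Set.mem_ofPred_eq, lt_abs, Set.mem_union, Set.mem_Iio, Set.mem_Ioi, lt_neg, or_comm]
  have hleft : ∫⁻ α in Set.Iio (-A), ENNReal.ofReal (|α| ^ (-p))
      = ∫⁻ α in Set.Ioi A, ENNReal.ofReal (|α| ^ (-p)) := by
    have := (Measure.measurePreserving_neg (volume : Measure ℝ)).setLIntegral_comp_preimage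
      (s := Set.Iio (-A)) measurableSet_Iio
      (f := fun α => ENNReal.ofReal (|α| ^ (-p))) (by fun_prop)
    rw [← this]
    simp
  rw [hset]
  refine (lintegral_union_le _ _ _).trans ?_
  rw [hleft, two_mul, ENNReal.ofReal_add (by positivity) (by positivity)]
  exact add_le_add hright hright

lemma one_add_log_pow_le {P : ℝ} (hP : 1 ≤ P) {s : ℕ} (hs : 0 < s) :
    (1 + Real.log P) ^ s ≤ (1 + 4 * s) ^ s * P ^ (1 / 4 : ℝ) := by
  have hs0 : (0 : ℝ) < s := by exact_mod_cast hs
  have hε : (0 : ℝ) < 1 / (4 * s) := by positivity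
  have h1 := Real.log_le_rpow_div (by linarith : 0 ≤ P) hε
  have h2 : 1 ≤ P ^ (1 / (4 * s) : ℝ) := Real.one_le_rpow hP hε.le
  have h3 : 1 + Real.log P ≤ (1 + 4 * s) * P ^ (1 / (4 * s) : ℝ) := by
    rw [div_div_eq_mul_div, div_one] at h1
    linarith
  have hlog := Real.log_nonneg hP
  calc (1 + Real.log P) ^ s ≤ ((1 + 4 * s) * P ^ (1 / (4 * s) : ℝ)) ^ s :=
        pow_le_pow_left₀ (by linarith) h3 s
    _ = _ := by
        rw [mul_pow, ← Real.rpow_natCast (P ^ _), ← Real.rpow_mul (by linarith)]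
        congr 2
        field_simp

lemma dlt_le {k : ℕ} (hk : 2 ≤ k) : dlt k ≤ 1 / 4096 := by
  rw [dlt, show (1 / 4096 : ℝ) = ((8 : ℝ) ^ 4)⁻¹ by norm_num]
  exact inv_anti₀ (by norm_num) (pow_le_pow_right₀ (by norm_num) (by omega))

lemma setLIntegral_dEta_le {A p η D E : ℝ} (hA : 0 < A) (hp : 2 ≤ p) (hη : 0 < η) (hη2 : η ≤ 2)
    (hD : 0 ≤ D) (hE : 0 ≤ E) :
    ∫⁻ α in {α : ℝ | A < |α|}, ENNReal.ofReal (D + E * |α| ^ (-p)) ∂dEta η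
      ≤ ENNReal.ofReal (2 * Real.pi * D + 4 * E * A ^ (1 - p)) := by
  have hsplit : ∀ α : ℝ, ENNReal.ofReal (D + E * |α| ^ (-p))
      = ENNReal.ofReal D + ENNReal.ofReal E * ENNReal.ofReal (|α| ^ (-p)) := fun α => by
    rw [ENNReal.ofReal_add hD (by positivity), ENNReal.ofReal_mul hE]
  simp only [hsplit]
  rw [lintegral_add_left measurable_const, lintegral_const, Measure.restrict_apply_univ,
    lintegral_const_mul _ (by fun_prop), ENNReal.ofReal_add (by positivity) (by positivity)]
  refine add_le_add ?_ ?_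
  · rw [mul_comm (2 * Real.pi), ENNReal.ofReal_mul hD]
    gcongr
    exact (measure_mono (Set.subset_univ _)).trans (dEta_univ_le hη)
  · rw [show 4 * E * A ^ (1 - p) = E * (2 * (2 * A ^ (1 - p))) by ring, ENNReal.ofReal_mul hE]
    gcongr
    refine (lintegral_mono' (Measure.restrict_mono subset_rfl (dEta_le hη2)) le_rfl).trans ?_
    rw [Measure.restrict_smul, lintegral_smul_measure, ENNReal.ofReal_mul (by norm_num),
      ENNReal.ofReal_ofNat, smul_eq_mul]
    gcongr
    exact lintegral_abs_rpow_le hA hp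

/-- For k ≥ 2, s > 2k, C ≥ 2, δ = 8^{−2k}, uniformly in 0 < η ≤ 2 and
P ≥ 2: ∫_{Λ_k^{(s)}(C)} ∫_{|α| > P^{1/3−k}} |f(λ_1α)⋯f(λ_sα)| d_ηα dλ ≪ P^{s−k−10δ}. -/
theorem stmt15 (k s : ℕ) (hk : 2 ≤ k) (hs : 2 * k < s) (C : ℝ) (hC : 2 ≤ C) :
    ∃ c : ℝ, 0 < c ∧ ∀ P : ℝ, 2 ≤ P → ∀ η : ℝ, 0 < η → η ≤ 2 →
      (∫⁻ l in LamC k s C, ∫⁻ α in {α : ℝ | P ^ ((1 : ℝ) / 3 - k) < |α|},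
          (‖∏ j, fW k P (l j * α)‖₊ : ENNReal) ∂dEta η)
        ≤ ENNReal.ofReal (c * P ^ ((s : ℝ) - k - 10 * dlt k)) := by
  have hs0 : 0 < s := by omega
  have hk0 : (0 : ℝ) < k := by positivity
  have hsk : (2 : ℝ) * k < s := by exact_mod_cast hs
  have hp : 2 ≤ (s : ℝ) / k := by
    rw [le_div_iff₀ hk0]
    exact hsk.le
  set K : ℝ := (8 * C) ^ s * 2 ^ (s - 1) with hK
  have hK0 : 0 < K := by positivity
  refine ⟨2 * Real.pi * K + 4 * K * (1 + 4 * s) ^ s, by positivity, fun P hP η hη hη2 => ?_⟩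
  have hP0 : 0 < P := by linarith
  have hP1 : 1 ≤ P := by linarith
  have hlog : 0 ≤ Real.log P := Real.log_nonneg hP1
  set A : ℝ := P ^ ((1 : ℝ) / 3 - k) with hA
  have hA0 : 0 < A := by positivity
  set S : Set ℝ := {α : ℝ | A < |α|} with hS
  have hSm : MeasurableSet S := measurableSet_lt measurable_const measurable_abs
  have : SFinite (dEta η) := by
    rw [dEta]
    infer_instance
  have hmeas : Continuous (Function.uncurry fun (l : Fin s → ℝ) (α : ℝ) =>
      (‖∏ j, fW k P (l j * α)‖₊ : ENNReal)) := by
    refine ENNReal.continuous_coe.comp (Continuous.nnnorm ?_)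
    exact continuous_finsetProd _ fun j _ => (continuous_fW k P).comp (by fun_prop)
  rw [lintegral_lintegral_swap hmeas.measurable.aemeasurable]
  have hpt : ∀ α ∈ S, ∫⁻ l in LamC k s C, (‖∏ j, fW k P (l j * α)‖₊ : ENNReal)
      ≤ ENNReal.ofReal (K * P ^ (s / 2 : ℝ)
        + K * (1 + Real.log P) ^ s * |α| ^ (-((s : ℝ) / k))) := by
    intro α hα
    have hα0 : α ≠ 0 := abs_pos.mp (hA0.trans hα)
    refine (lintegral_LamC_le (setIntegral_norm_fW_le hk (by linarith) hα0 hP1)).trans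
      (ENNReal.ofReal_le_ofReal ?_)
    have h1 : √P ^ s = P ^ (s / 2 : ℝ) := by
      rw [Real.sqrt_eq_rpow, ← Real.rpow_natCast, ← Real.rpow_mul hP0.le]
      congr 1
      ring
    have h2 : (|α| ^ (-(1 / k : ℝ))) ^ s = |α| ^ (-((s : ℝ) / k)) := by
      rw [← Real.rpow_natCast, ← Real.rpow_mul (abs_nonneg α)]
      congr 1
      ring
    rw [mul_pow _ _ s, hK]
    refine (mul_le_mul_of_nonneg_left (add_pow_le (Real.sqrt_nonneg P)
      (by positivity : 0 ≤ |α| ^ (-(1 / k : ℝ)) * (1 + Real.log P)) s)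
      (by positivity)).trans (le_of_eq ?_)
    rw [h1, mul_pow (|α| ^ _), h2]
    ring
  refine (setLIntegral_mono' hSm hpt).trans ?_
  refine (setLIntegral_dEta_le hA0 hp hη hη2 (by positivity) (by positivity)).trans
    (ENNReal.ofReal_le_ofReal ?_)
  have hδ := dlt_le hk
  have hsk1 : (2 : ℝ) * k + 1 ≤ s := by exact_mod_cast hs
  have h1 : P ^ (s / 2 : ℝ) ≤ P ^ ((s : ℝ) - k - 10 * dlt k) :=
    Real.rpow_le_rpow_of_exponent_le hP1 (by linarith)
  have h2 : (1 + Real.log P) ^ s * A ^ (1 - (s : ℝ) / k)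
      ≤ (1 + 4 * s) ^ s * P ^ ((s : ℝ) - k - 10 * dlt k) := by
    refine (mul_le_mul_of_nonneg_right (one_add_log_pow_le hP1 hs0) (by positivity)).trans ?_
    rw [hA, ← Real.rpow_mul hP0.le, mul_assoc, ← Real.rpow_add hP0]
    refine mul_le_mul_of_nonneg_left (Real.rpow_le_rpow_of_exponent_le hP1 ?_) (by positivity)
    have h3 : ((1 : ℝ) / 3 - k) * (1 - s / k) = 1 / 3 - (s / k) / 3 - k + s := by
      field_simp
      ring
    rw [h3]
    linarith
  calc _ = 2 * Real.pi * K * P ^ (s / 2 : ℝ)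
          + 4 * K * ((1 + Real.log P) ^ s * A ^ (1 - (s : ℝ) / k)) := by ring
    _ ≤ 2 * Real.pi * K * P ^ ((s : ℝ) - k - 10 * dlt k)
          + 4 * K * ((1 + 4 * s) ^ s * P ^ ((s : ℝ) - k - 10 * dlt k)) := by gcongr
    _ = _ := by ring
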